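/- Let C be a permutation-invariant partition of the player set of a finite normal-form game with identical interests. Then the set of mean-centric equilibria relative to C is non-empty. -/

import Mathlib

open MeasureTheory Filter Topology

noncomputable section

namespace ECFP

variable {ι A κ : Type*}

/-- The mixed-strategy simplex over a finite action set `Y` inside the action universe `A`. -/
def simplex (Y : Finset A) : Set (A → ℝ) :=
  {p | (∀ a, 0 ≤ p a) ∧ (∀ a, a ∉ Y → p a = 0) ∧ ∑ a ∈ Y, p a = 1}

/-- The space `Δⁿ` of joint mixed strategies. -/
def Delta (Y : ι → Finset A) : Set (ι → A → ℝ) :=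
  {p | ∀ i, p i ∈ simplex (Y i)}

variable [Fintype ι] [DecidableEq ι] [Fintype A] [DecidableEq κ]

/-- The mixed extension of the common utility `u`:
`U(p₁,…,pₙ) = ∑_y u(y) p₁(y₁)⋯pₙ(yₙ)`. -/
def U (u : (ι → A) → ℝ) (p : ι → A → ℝ) : ℝ :=
  ∑ y : ι → A, u y * ∏ i, p i (y i)

/-- The `ε`-best-response set of player `i` against the joint strategy `p`
(only the components `p_{-i}` matter, since player `i`'s component is overwritten):
`{pᵢ ∈ Δᵢ : U(pᵢ,p_{-i}) ≥ U(qᵢ,p_{-i}) - ε  ∀ qᵢ ∈ Δᵢ}`. -/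
def BRi (Y : ι → Finset A) (u : (ι → A) → ℝ) (ε : ℝ) (p : ι → A → ℝ) (i : ι) :
    Set (A → ℝ) :=
  {pi | pi ∈ simplex (Y i) ∧
    ∀ qi ∈ simplex (Y i),
      U u (Function.update p i pi) ≥ U u (Function.update p i qi) - ε}

/-- The joint `ε`-best-response set `BR^ε(p) = (BR₁^ε(p_{-1}),…,BRₙ^ε(p_{-n}))`. -/
def BR (Y : ι → Finset A) (u : (ι → A) → ℝ) (ε : ℝ) (p : ι → A → ℝ) :
    Set (ι → A → ℝ) :=
  {b | ∀ i, b i ∈ BRi Y u ε p i}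

/-- The profile obtained from `y` by swapping the strategies of players `i` and `j`. -/
def swapStrat (y : ι → A) (i j : ι) : ι → A :=
  Function.update (Function.update y i (y j)) j (y i)

/-- `cls : ι → κ` encodes a permutation-invariant partition of the player set (the classes
are the fibers of `cls`): players in the same class have the same action set, and the utility
is invariant under swapping the strategies of two same-class players in any strategy profile. -/
def PermInvariant (Y : ι → Finset A) (u : (ι → A) → ℝ) (cls : ι → κ) : Prop :=
  ∀ i j : ι, cls i = cls j →
    Y i = Y j ∧ ∀ y : ι → A, (∀ k, y k ∈ Y k) → u (swapStrat y i j) = u y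

/-- The equivalence class (as a finset of players) of player `i`. -/
def cluster (cls : ι → κ) (i : ι) : Finset ι :=
  Finset.univ.filter (fun j => cls j = cls i)

/-- The centroid distribution `p̄`: player `i` is assigned the average of the strategies of
the players in `i`'s class. -/
def centroid (cls : ι → κ) (p : ι → A → ℝ) : ι → A → ℝ :=
  fun i => ((cluster cls i).card : ℝ)⁻¹ • ∑ j ∈ cluster cls i, p j

/-- A joint strategy is class-constant if same-class players use identical strategies. -/
def classConst (cls : ι → κ) (p : ι → A → ℝ) : Prop :=
  ∀ i j, cls i = cls j → p i = p j

/-- The set of Nash equilibria. -/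
def NE (Y : ι → Finset A) (u : (ι → A) → ℝ) : Set (ι → A → ℝ) :=
  {p | p ∈ Delta Y ∧ ∀ i, ∀ qi ∈ simplex (Y i),
    U u (Function.update p i qi) ≤ U u p}

/-- The set of symmetric Nash equilibria relative to the partition `cls`. -/
def SNE (Y : ι → Finset A) (u : (ι → A) → ℝ) (cls : ι → κ) : Set (ι → A → ℝ) :=
  {p | p ∈ NE Y u ∧ classConst cls p}

/-- The set of mean-centric equilibria relative to the partition `cls`:
`U(pᵢ, p̄_{-i}) ≥ U(pᵢ', p̄_{-i})` for all `pᵢ' ∈ Δᵢ` and all `i`. -/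
def MCE (Y : ι → Finset A) (u : (ι → A) → ℝ) (cls : ι → κ) : Set (ι → A → ℝ) :=
  {p | p ∈ Delta Y ∧ ∀ i, ∀ qi ∈ simplex (Y i),
    U u (Function.update (centroid cls p) i qi)
      ≤ U u (Function.update (centroid cls p) i (p i))}

/-- `V(p) = (1/n) ∑ᵢ U(pᵢ, p̄_{-i})`. -/
def Vfun (u : (ι → A) → ℝ) (cls : ι → κ) (p : ι → A → ℝ) : ℝ :=
  (Fintype.card ι : ℝ)⁻¹ * ∑ i, U u (Function.update (centroid cls p) i (p i))

/-- A discrete-time ECFP process w.r.t. `(Γ, 𝒞)`: `q(1) = a(1)`,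
`q(t+1) = q(t) + γₜ (a(t+1) − q(t))` and `a(t+1) ∈ BR^{εₜ}(q̄(t))` for all `t`
(time is indexed by `ℕ`, i.e. `t = 0` plays the role of `t = 1` in the paper). -/
structure IsECFP (Y : ι → Finset A) (u : (ι → A) → ℝ) (cls : ι → κ)
    (γ ε : ℕ → ℝ) (a q : ℕ → ι → A → ℝ) : Prop where
  a_init_mem : a 0 ∈ Delta Y
  q_mem : ∀ t, q t ∈ Delta Y
  init : q 0 = a 0
  step : ∀ t, q (t + 1) = q t + γ t • (a (t + 1) - q t)
  br : ∀ t, a (t + 1) ∈ BR Y u (ε t) (centroid cls (q t))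

/-- A solution of the differential inclusion `ẋ ∈ F(x)` taking values in `Δⁿ`:
an everywhere-`Δⁿ`-valued trajectory on `[0,∞)` which is the integral of a locally
integrable selection `g(t) ∈ F(x(t))` (a.e.). -/
def IsSolution (Y : ι → Finset A) (F : (ι → A → ℝ) → Set (ι → A → ℝ))
    (x : ℝ → ι → A → ℝ) : Prop :=
  (∀ t : ℝ, 0 ≤ t → x t ∈ Delta Y) ∧
  ∃ g : ℝ → ι → A → ℝ,
    LocallyIntegrableOn g (Set.Ici (0 : ℝ)) ∧
    (∀ᵐ t ∂(volume.restrict (Set.Ici (0 : ℝ))), g t ∈ F (x t)) ∧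
    ∀ t : ℝ, 0 ≤ t → x t = x 0 + ∫ s in Set.Ioc (0 : ℝ) t, g s

/-- Right-hand side of the joint CT-ECFP differential inclusion `q̇ ∈ BR(q̄) − q`. -/
def Fjoint (Y : ι → Finset A) (u : (ι → A) → ℝ) (cls : ι → κ)
    (q : ι → A → ℝ) : Set (ι → A → ℝ) :=
  (fun b => b - q) '' BR Y u 0 (centroid cls q)

/-- Right-hand side of the centroid CT-ECFP differential inclusion `ẏ ∈ BR(y) − y`. -/
def Fcent (Y : ι → Finset A) (u : (ι → A) → ℝ)
    (y : ι → A → ℝ) : Set (ι → A → ℝ) :=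
  (fun b => b - y) '' BR Y u 0 y

/-- The ω-limit set of a continuous-time trajectory: all limits of sequences
`x(t_k)` with `t_k → ∞`. -/
def omegaLimitSet (x : ℝ → ι → A → ℝ) : Set (ι → A → ℝ) :=
  {p | ∃ tk : ℕ → ℝ, Tendsto tk atTop atTop ∧ Tendsto (fun k => x (tk k)) atTop (𝓝 p)}

/-- The set of limit points of a (discrete-time) sequence. -/
def seqLimitPoints (q : ℕ → ι → A → ℝ) : Set (ι → A → ℝ) :=
  {p | ∃ φ : ℕ → ℕ, StrictMono φ ∧ Tendsto (fun k => q (φ k)) atTop (𝓝 p)}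

/-- A compact set `X ⊆ Δⁿ` is internally chain transitive for the inclusion `ẋ ∈ F(x)`:
any two points of `X` can be joined, for every `ε > 0` and `T > 0`, by finitely many
solution pieces of duration `> T` staying in `X`, with jumps of size `≤ ε`. -/
def InternallyChainTransitive (Y : ι → Finset A)
    (F : (ι → A → ℝ) → Set (ι → A → ℝ)) (X : Set (ι → A → ℝ)) : Prop :=
  IsCompact X ∧ X ⊆ Delta Y ∧
  ∀ ξ ∈ X, ∀ η ∈ X, ∀ ε : ℝ, 0 < ε → ∀ T : ℝ, 0 < T →
    ∃ k : ℕ, 0 < k ∧ ∃ x : ℕ → ℝ → ι → A → ℝ, ∃ tt : ℕ → ℝ,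
      (∀ i < k, IsSolution Y F (x i)) ∧
      (∀ i < k, T < tt i) ∧
      (∀ i < k, ∀ s : ℝ, 0 ≤ s → s ≤ tt i → x i s ∈ X) ∧
      (∀ i, i + 1 < k → ‖x i (tt i) - x (i + 1) 0‖ ≤ ε) ∧
      ‖x 0 0 - ξ‖ ≤ ε ∧ ‖x (k - 1) (tt (k - 1)) - η‖ ≤ ε

theorem isCompact_simplex (S : Finset A) : IsCompact (simplex S) := by
  refine IsCompact.of_isClosed_subset (isCompact_Icc (a := (0 : A → ℝ)) (b := 1)) ?_ ?_
  · refine IsClosed.and ?_ (IsClosed.and ?_ ?_)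
    · simp only [Set.ofPred_forall]
      exact isClosed_iInter fun a => isClosed_le continuous_const (continuous_apply a)
    · simp only [Set.ofPred_forall]
      exact isClosed_iInter fun a => isClosed_iInter fun _ =>
        isClosed_eq (continuous_apply a) continuous_const
    · exact isClosed_eq (by fun_prop) continuous_const
  · rintro p ⟨h0, hS, h1⟩
    refine ⟨h0, fun a => ?_⟩
    by_cases ha : a ∈ S
    · exact (Finset.single_le_sum (fun b _ => h0 b) ha).trans_eq h1
    · simp [hS a ha]

theorem convex_simplex (S : Finset A) : Convex ℝ (simplex S) := by
  rintro p ⟨hp0, hpS, hp1⟩ q ⟨hq0, hqS, hq1⟩ a b ha hb hab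
  refine ⟨fun x => ?_, fun x hx => ?_, ?_⟩
  · have := hp0 x
    have := hq0 x
    simp only [Pi.add_apply, Pi.smul_apply, smul_eq_mul]
    positivity
  · simp [hpS x hx, hqS x hx]
  · simp [Finset.sum_add_distrib, ← Finset.mul_sum, hp1, hq1, hab]

theorem uniform_mem_simplex {S : Finset A} (hS : S.Nonempty) :
    Set.indicator (S : Set A) (fun _ => (S.card : ℝ)⁻¹) ∈ simplex S := by
  have hc : (S.card : ℝ) ≠ 0 := by exact_mod_cast hS.card_pos.ne'
  refine ⟨fun a => Set.indicator_nonneg (fun _ _ => by positivity) a,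
    fun a ha => Set.indicator_of_notMem (by simpa using ha) _, ?_⟩
  rw [Finset.sum_congr rfl fun a ha => Set.indicator_of_mem (Finset.mem_coe.2 ha) _]
  simp [hc]

theorem continuous_U (u : (ι → A) → ℝ) : Continuous (U u) := by
  unfold U
  fun_prop

theorem prod_update_apply (p : ι → A → ℝ) (k : ι) (q : A → ℝ) (y : ι → A) :
    ∏ j, Function.update p k q j (y j) = q (y k) * ∏ j ∈ Finset.univ.erase k, p j (y j) := by
  rw [← Finset.mul_prod_erase _ _ (Finset.mem_univ k), Function.update_self]
  congr 1
  exact Finset.prod_congr rfl fun j hj => by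
    rw [Function.update_of_ne (Finset.ne_of_mem_erase hj)]

theorem U_update_sub (u : (ι → A) → ℝ) (p : ι → A → ℝ) (k : ι) (q r : A → ℝ) :
    U u (Function.update p k (q - r)) =
      U u (Function.update p k q) - U u (Function.update p k r) := by
  simp only [U, prod_update_apply, ← Finset.sum_sub_distrib]
  exact Finset.sum_congr rfl fun y _ => by simp only [Pi.sub_apply]; ring

theorem U_update_zero (u : (ι → A) → ℝ) (p : ι → A → ℝ) (k : ι) :
    U u (Function.update p k 0) = 0 := by
  simp [U, prod_update_apply]

theorem hasDerivAt_U_add_smul (u : (ι → A) → ℝ) (p d : ι → A → ℝ) :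
    HasDerivAt (fun t : ℝ => U u (p + t • d)) (∑ k, U u (Function.update p k (d k))) 0 := by
  have hline (k : ι) (y : ι → A) :
      HasDerivAt (fun t : ℝ => (p + t • d) k (y k)) (d k (y k)) 0 := by
    simpa using ((hasDerivAt_id (0 : ℝ)).mul_const (d k (y k))).const_add (p k (y k))
  have h := HasDerivAt.fun_sum (u := Finset.univ) fun (y : ι → A) _ =>
    (HasDerivAt.fun_finsetProd (u := Finset.univ) fun k _ => hline k y).const_mul (u y)
  refine h.congr_deriv ?_
  simp only [U, prod_update_apply]
  rw [Finset.sum_comm]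
  refine Finset.sum_congr rfl fun y _ => ?_
  rw [Finset.mul_sum]
  exact Finset.sum_congr rfl fun k _ => by simp [mul_comm]

theorem swapStrat_eq_comp_swap (y : ι → A) (i j : ι) : swapStrat y i j = y ∘ Equiv.swap i j := by
  ext k
  simp only [swapStrat, Function.comp_apply, Function.update_apply, Equiv.swap_apply_def]
  split_ifs <;> simp_all

theorem U_comp_swap {Y : ι → Finset A} {u : (ι → A) → ℝ} {cls : ι → κ}
    (hpi : PermInvariant Y u cls) {i j : ι} (hij : cls i = cls j) {p : ι → A → ℝ}
    (hp : p ∈ Delta Y) : U u (p ∘ Equiv.swap i j) = U u p := by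
  have hreindex (y : ι → A) :
      ∏ k, (p ∘ Equiv.swap i j) k ((y ∘ Equiv.swap i j) k) = ∏ k, p k (y k) :=
    Equiv.prod_comp (Equiv.swap i j) fun k => p k (y k)
  have hsymm : (Equiv.swap i j).symm = Equiv.swap i j := Equiv.symm_swap i j
  unfold U
  rw [← Equiv.sum_comp (Equiv.arrowCongr (Equiv.swap i j) (Equiv.refl A))]
  refine Finset.sum_congr rfl fun y _ => ?_
  have hy : Equiv.arrowCongr (Equiv.swap i j) (Equiv.refl A) y = y ∘ Equiv.swap i j := by
    ext k
    simp [Equiv.arrowCongr]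
  rw [hy, hreindex]
  by_cases hyY : ∀ k, y k ∈ Y k
  · rw [← swapStrat_eq_comp_swap, (hpi i j hij).2 y hyY]
  · push Not at hyY
    obtain ⟨k, hk⟩ := hyY
    rw [Finset.prod_eq_zero (Finset.mem_univ k) ((hp k).2.1 _ hk), mul_zero, mul_zero]

theorem update_mem_Delta {Y : ι → Finset A} {p : ι → A → ℝ} (hp : p ∈ Delta Y) {i : ι}
    {q : A → ℝ} (hq : q ∈ simplex (Y i)) : Function.update p i q ∈ Delta Y := by
  intro k
  rcases eq_or_ne k i with rfl | hk
  · simpa using hq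
  · simpa [hk] using hp k

theorem U_update_eq_of_classConst {Y : ι → Finset A} {u : (ι → A) → ℝ} {cls : ι → κ}
    (hpi : PermInvariant Y u cls) {i j : ι} (hij : cls i = cls j) {p : ι → A → ℝ}
    (hp : p ∈ Delta Y) (hc : classConst cls p) {q : A → ℝ} (hq : q ∈ simplex (Y i)) :
    U u (Function.update p j q) = U u (Function.update p i q) := by
  rw [← U_comp_swap hpi hij (update_mem_Delta hp hq)]
  congr 1
  funext k
  have := hc i j hij
  simp only [Function.comp_apply, Function.update_apply, Equiv.swap_apply_def]
  split_ifs <;> simp_all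

theorem centroid_eq_of_classConst {cls : ι → κ} {p : ι → A → ℝ} (hc : classConst cls p) :
    centroid cls p = p := by
  funext i
  have hne : ((cluster cls i).card : ℝ) ≠ 0 := by
    have : i ∈ cluster cls i := by simp [cluster]
    exact_mod_cast (Finset.card_pos.2 ⟨i, this⟩).ne'
  rw [centroid, Finset.sum_congr rfl fun j hj => hc j i (by simpa [cluster] using hj),
    Finset.sum_const, ← Nat.cast_smul_eq_nsmul ℝ, smul_smul, inv_mul_cancel₀ hne, one_smul]

theorem isCompact_Delta_inter_classConst (Y : ι → Finset A) (cls : ι → κ) :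
    IsCompact (Delta Y ∩ {p | classConst cls p}) := by
  have hD : Delta Y = Set.univ.pi fun i => simplex (Y i) := by
    ext p
    simp [Delta]
  rw [hD]
  refine (isCompact_univ_pi fun i => isCompact_simplex (Y i)).inter_right ?_
  simp only [classConst, Set.ofPred_forall]
  exact isClosed_iInter fun i => isClosed_iInter fun j => isClosed_iInter fun _ =>
    isClosed_eq (continuous_apply i) (continuous_apply j)

/-- Moving a whole class from a class-constant maximizer towards a deviation `q` has directional
derivative proportional to the gain of a single deviating player. -/
theorem mem_SNE_of_isMaxOn {Y : ι → Finset A} {u : (ι → A) → ℝ} {cls : ι → κ}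
    (hpi : PermInvariant Y u cls) {p : ι → A → ℝ} (hp : p ∈ Delta Y) (hc : classConst cls p)
    (hmax : IsMaxOn (U u) (Delta Y ∩ {p | classConst cls p}) p) : p ∈ SNE Y u cls := by
  refine ⟨⟨hp, fun i q hq => ?_⟩, hc⟩
  set d : ι → A → ℝ := fun k => if cls k = cls i then q - p k else 0 with hd
  have hder := hasDerivAt_U_add_smul u p d
  have hsum : ∑ k, U u (Function.update p k (d k)) =
      (cluster cls i).card * (U u (Function.update p i q) - U u p) := by
    have hterm (k : ι) : U u (Function.update p k (d k)) =
        if cls k = cls i then U u (Function.update p i q) - U u p else 0 := by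
      by_cases hk : cls k = cls i
      · simp only [hd, if_pos hk]
        rw [U_update_sub, Function.update_eq_self,
          U_update_eq_of_classConst hpi hk.symm hp hc hq]
      · simp only [hd, if_neg hk, U_update_zero]
    rw [Finset.sum_congr rfl fun k _ => hterm k, ← Finset.sum_filter, Finset.sum_const,
      nsmul_eq_mul, cluster]
  have hmem {t : ℝ} (ht0 : 0 < t) (ht1 : t < 1) :
      p + t • d ∈ Delta Y ∩ {p | classConst cls p} := by
    refine ⟨fun k => ?_, fun j k hjk => ?_⟩
    · by_cases hk : cls k = cls i
      · have hq' : q ∈ simplex (Y k) := (hpi k i hk).1 ▸ hq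
        simpa [hd, hk] using
          (convex_simplex (Y k)).add_smul_sub_mem (hp k) hq' ⟨ht0.le, ht1.le⟩
      · simpa [hd, hk] using hp k
    · simp [hd, hjk, hc j k hjk]
  have hle : ∑ k, U u (Function.update p k (d k)) ≤ 0 := by
    refine le_of_tendsto hder.tendsto_slope_zero_right ?_
    filter_upwards [Ioo_mem_nhdsGT (zero_lt_one' ℝ)] with t ht
    have := isMaxOn_iff.1 hmax _ (hmem ht.1 ht.2)
    refine mul_nonpos_of_nonneg_of_nonpos (inv_nonneg.2 ht.1.le) ?_
    simpa using this
  have hpos : (0 : ℝ) < (cluster cls i).card := by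
    exact_mod_cast Finset.card_pos.2 ⟨i, by simp [cluster]⟩
  rw [hsum] at hle
  exact sub_nonpos.1 (nonpos_of_mul_nonpos_right hle hpos)

theorem SNE_nonempty {Y : ι → Finset A} (hY : ∀ i, (Y i).Nonempty) {u : (ι → A) → ℝ}
    {cls : ι → κ} (hpi : PermInvariant Y u cls) : (SNE Y u cls).Nonempty := by
  obtain ⟨p, ⟨hp, hc⟩, hmax⟩ := (isCompact_Delta_inter_classConst Y cls).exists_isMaxOn
    ⟨_, fun i => uniform_mem_simplex (hY i), fun i j hij => by rw [(hpi i j hij).1]⟩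
    (continuous_U u).continuousOn
  exact ⟨p, mem_SNE_of_isMaxOn hpi hp hc hmax⟩

theorem SNE_subset_MCE (Y : ι → Finset A) (u : (ι → A) → ℝ) (cls : ι → κ) :
    SNE Y u cls ⊆ MCE Y u cls := by
  rintro p ⟨⟨hp, hbest⟩, hc⟩
  refine ⟨hp, fun i q hq => ?_⟩
  rw [centroid_eq_of_classConst hc, Function.update_eq_self]
  exact hbest i q hq

variable [Nonempty ι]

/-- The set of mean-centric equilibria relative to a permutation-invariant partition of an
identical-interests game is non-empty. -/
theorem MCE_nonempty
    (Y : ι → Finset A) (hY : ∀ i, (Y i).Nonempty) (u : (ι → A) → ℝ)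
    (cls : ι → κ) (hpi : PermInvariant Y u cls) :
    (MCE Y u cls).Nonempty := by
  exact (SNE_nonempty hY hpi).mono (SNE_subset_MCE Y u cls)

end ECFP
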